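/- For all nonnegative integers m and n and all x > 0, the inequality Φ^{(m+n+1)}(x)·(Φ^{(m)}·Φ^{(n)})'(x) > Φ^{(m+n+2)}(x)·Φ^{(m)}(x)·Φ^{(n)}(x) holds, where (Φ^{(m)}·Φ^{(n)})'(x) = Φ^{(m+1)}(x)Φ^{(n)}(x) + Φ^{(m)}(x)Φ^{(n+1)}(x). -/

import Mathlib

/-- `Φ x = x * ψ'(x) - 1`, where `ψ'` is the trigamma function, i.e. the second
derivative of the logarithm of the gamma function. -/
noncomputable def Phi (x : ℝ) : ℝ :=
  x * iteratedDeriv 2 (fun y => Real.log (Real.Gamma y)) x - 1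

open Real Set Filter Topology MeasureTheory

theorem exists_antideriv_Ioi {f : ℝ → ℝ} (hf : ContinuousOn f (Ioi 0)) :
    ∃ F : ℝ → ℝ, ∀ x > 0, HasDerivAt F (f x) x := by
  refine ⟨fun x => ∫ t in (1 : ℝ)..x, f t, fun x hx => ?_⟩
  refine intervalIntegral.integral_hasDerivAt_right ?_ ?_ (hf.continuousAt (Ioi_mem_nhds hx))
  · refine (hf.mono fun t ht => ?_).intervalIntegrable
    exact lt_of_lt_of_le (lt_min one_pos hx) ht.1
  · exact hf.stronglyMeasurableAtFilter isOpen_Ioi x hx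

theorem exists_const_of_hasDerivAt_zero_Ioi {f : ℝ → ℝ}
    (hf : ∀ x > 0, HasDerivAt f 0 x) : ∃ c, ∀ x > 0, f x = c := by
  refine ⟨f 1, fun x hx => ?_⟩
  refine isOpen_Ioi.is_const_of_deriv_eq_zero (s := Ioi (0 : ℝ)) isPreconnected_Ioi
    (fun y hy => (hf y hy).differentiableAt.differentiableWithinAt)
    (fun y hy => (hf y hy).deriv) hx (mem_Ioi.2 one_pos)

/-- A nonnegative function which satisfies the functional equation of the trigamma function and
tends to zero at infinity is the trigamma function. -/
theorem iteratedDeriv_two_log_Gamma_eq {K : ℝ → ℝ} (hc : ContinuousOn K (Ioi 0))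
    (h0 : ∀ x > 0, 0 ≤ K x) (hK : ∀ x > 0, K (x + 1) = K x - 1 / x ^ 2)
    (hlim : Tendsto K atTop (𝓝 0)) {x : ℝ} (hx : 0 < x) :
    iteratedDeriv 2 (fun y => log (Gamma y)) x = K x := by
  obtain ⟨k, hk⟩ := exists_antideriv_Ioi hc
  have hkc : ContinuousOn k (Ioi 0) := fun y hy => (hk y hy).continuousAt.continuousWithinAt
  obtain ⟨G, hG⟩ := exists_antideriv_Ioi hkc
  have shift : ∀ {f f' : ℝ → ℝ}, (∀ y > 0, HasDerivAt f (f' y) y) →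
      ∀ y > 0, HasDerivAt (fun z => f (z + 1)) (f' (y + 1)) y := fun hf y hy =>
    (hf (y + 1) (by linarith)).comp_add_const y 1
  have hkstep : ∀ y > 0, k (y + 1) - k y = 1 / y := by
    obtain ⟨α, hα⟩ := exists_const_of_hasDerivAt_zero_Ioi
      (f := fun y => k (y + 1) - k y - y⁻¹) fun y hy => by
        refine (((shift hk y hy).sub (hk y hy)).sub (hasDerivAt_inv hy.ne')).congr_deriv ?_
        rw [hK y hy]; ring
    have hα0 : α = 0 := by
      have hmvt : ∀ y > 0, ∃ c > y, α = K c - y⁻¹ := fun y hy => by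
        obtain ⟨c, hc, h⟩ := exists_hasDerivAt_eq_slope k K (by linarith : y < y + 1)
          (hkc.mono fun t ht => lt_of_lt_of_le hy ht.1) (fun t ht => hk t (hy.trans ht.1))
        refine ⟨c, hc.1, ?_⟩
        rw [h, ← hα y hy]; simp
      have hchoose : ∀ y, ∃ c, 0 < y → y < c ∧ α = K c - y⁻¹ := fun y => by
        by_cases hy : 0 < y
        · obtain ⟨c, h⟩ := hmvt y hy
          exact ⟨c, fun _ => h⟩
        · exact ⟨0, fun h => absurd h hy⟩
      choose c hc using hchoose
      have hct : Tendsto c atTop atTop := by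
        refine tendsto_atTop_mono' _ ?_ tendsto_id
        filter_upwards [eventually_gt_atTop 0] with y hy using (hc y hy).1.le
      have : Tendsto (fun y => K (c y) - y⁻¹) atTop (𝓝 (0 - 0)) :=
        (hlim.comp hct).sub tendsto_inv_atTop_zero
      rw [sub_zero] at this
      refine tendsto_nhds_unique (tendsto_const_nhds (f := (atTop : Filter ℝ))) (this.congr' ?_)
      filter_upwards [eventually_gt_atTop 0] with y hy using (hc y hy).2.symm
    intro y hy
    have := hα y hy
    rw [hα0] at this
    simp only [one_div]; linarith
  obtain ⟨β, hβ⟩ := exists_const_of_hasDerivAt_zero_Ioi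
    (f := fun y => G (y + 1) - G y - log y) fun y hy => by
      refine (((shift hG y hy).sub (hG y hy)).sub (hasDerivAt_log hy.ne')).congr_deriv ?_
      rw [hkstep y hy]; simp
  let L : ℝ → ℝ := fun y => G y - β * (y - 1) - G 1
  have hL : ∀ y > 0, HasDerivAt L (k y - β) y := fun y hy => by
    refine (((hG y hy).sub (((hasDerivAt_id y).sub_const 1).const_mul β)).sub_const
      (G 1)).congr_deriv ?_
    simp
  have hLconv : ConvexOn ℝ (Ioi 0) L := by
    refine MonotoneOn.convexOn_of_deriv (convex_Ioi 0)
      (fun y hy => (hL y hy).continuousAt.continuousWithinAt) ?_ ?_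
    · rw [interior_Ioi]
      exact fun y hy => (hL y hy).differentiableAt.differentiableWithinAt
    · rw [interior_Ioi]
      have hmono : MonotoneOn k (Ioi 0) := by
        refine monotoneOn_of_deriv_nonneg (convex_Ioi 0) hkc ?_ ?_
        · rw [interior_Ioi]
          exact fun y hy => (hk y hy).differentiableAt.differentiableWithinAt
        · rw [interior_Ioi]
          exact fun y hy => (hk y hy).deriv ▸ h0 y hy
      intro y hy z hz hyz
      rw [(hL y hy).deriv, (hL z hz).deriv]
      linarith [hmono hy hz hyz]
  have hΓ : EqOn (fun y => exp (L y)) Gamma (Ioi 0) := by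
    refine eq_Gamma_of_log_convex ?_ ?_ (fun _ => exp_pos _) ?_
    · convert hLconv using 1
      ext y; simp
    · intro y hy
      have : L (y + 1) = log y + L y := by
        have := hβ y hy
        simp only [L]; linarith
      rw [this, exp_add, exp_log hy]
    · simp [L]
  have hlog : ∀ y > 0, (fun y => log (Gamma y)) =ᶠ[𝓝 y] L := fun y hy => by
    filter_upwards [Ioi_mem_nhds hy] with z hz
    rw [← hΓ hz, log_exp]
  rw [iteratedDeriv_succ, iteratedDeriv_one]
  have : deriv (fun y => log (Gamma y)) =ᶠ[𝓝 x] fun y => k y - β := by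
    filter_upwards [Ioi_mem_nhds hx] with y hy
    rw [(hlog y hy).deriv_eq, (hL y hy).deriv]
  rw [this.deriv_eq]
  exact ((hk x hx).sub_const β).deriv

/-- The `k`-th moment of the Laplace transform of the weight `w`. -/
noncomputable def laplaceMoment (w : ℝ → ℝ) (k : ℕ) (x : ℝ) : ℝ :=
  ∫ t in Ioi 0, t ^ k * (w t * exp (-(x * t)))

theorem integrableOn_pow_mul_exp (k : ℕ) {x : ℝ} (hx : 0 < x) :
    IntegrableOn (fun t : ℝ => t ^ k * exp (-(x * t))) (Ioi 0) := by
  simpa using integrableOn_rpow_mul_exp_neg_mul_rpow (s := k) (p := 1)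
    (by linarith [k.cast_nonneg (α := ℝ)]) one_pos hx

theorem integral_pow_mul_exp (k : ℕ) {x : ℝ} (hx : 0 < x) :
    ∫ t in Ioi (0 : ℝ), t ^ k * exp (-(x * t)) = k.factorial / x ^ (k + 1) := by
  have := integral_rpow_mul_exp_neg_mul_Ioi (a := k + 1) (by positivity) hx
  rw [Gamma_nat_eq_factorial] at this
  simp only [add_sub_cancel_right, rpow_natCast] at this
  rw [this, ← Nat.cast_succ, rpow_natCast]
  simp [div_eq_mul_inv, mul_comm]

theorem integrableOn_laplaceMoment {w : ℝ → ℝ} (hm : Measurable w)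
    (hw : ∀ t > 0, 0 ≤ w t ∧ w t ≤ 1 + t) (k : ℕ) {x : ℝ} (hx : 0 < x) :
    IntegrableOn (fun t => t ^ k * (w t * exp (-(x * t)))) (Ioi 0) := by
  refine ((integrableOn_pow_mul_exp k hx).add (integrableOn_pow_mul_exp (k + 1) hx)).mono'
    (by fun_prop) ?_
  filter_upwards [ae_restrict_mem measurableSet_Ioi] with t (ht : 0 < t)
  obtain ⟨h0, h1⟩ := hw t ht
  rw [norm_of_nonneg (by positivity)]
  calc t ^ k * (w t * exp (-(x * t))) ≤ t ^ k * ((1 + t) * exp (-(x * t))) := by gcongr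
    _ = _ := by simp only [Pi.add_apply]; ring

theorem laplaceMoment_tendsto_zero {w : ℝ → ℝ} (hm : Measurable w)
    (hw : ∀ t > 0, 0 ≤ w t ∧ w t ≤ 1 + t) :
    Tendsto (laplaceMoment w 0) atTop (𝓝 0) := by
  have hlim : Tendsto (fun x : ℝ => x⁻¹ + x⁻¹ * x⁻¹) atTop (𝓝 0) := by
    simpa using tendsto_inv_atTop_zero.add
      ((tendsto_inv_atTop_zero (𝕜 := ℝ)).mul tendsto_inv_atTop_zero)
  refine tendsto_of_tendsto_of_tendsto_of_le_of_le' tendsto_const_nhds hlim ?_ ?_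
  · refine Eventually.of_forall fun x => setIntegral_nonneg measurableSet_Ioi fun t ht => ?_
    have := (hw t ht).1
    positivity
  · filter_upwards [eventually_gt_atTop 0] with x hx
    have h0 := integral_pow_mul_exp 0 hx
    have h1 := integral_pow_mul_exp 1 hx
    calc laplaceMoment w 0 x
        ≤ ∫ t in Ioi (0 : ℝ), (t ^ 0 * exp (-(x * t)) + t ^ 1 * exp (-(x * t))) := by
          refine setIntegral_mono_on (integrableOn_laplaceMoment hm hw 0 hx)
            ((integrableOn_pow_mul_exp 0 hx).add (integrableOn_pow_mul_exp 1 hx))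
            measurableSet_Ioi fun t ht => ?_
          rw [← add_mul, pow_zero, pow_one, one_mul]
          gcongr
          exact (hw t ht).2
      _ = x⁻¹ + x⁻¹ * x⁻¹ := by
          rw [integral_add (integrableOn_pow_mul_exp 0 hx) (integrableOn_pow_mul_exp 1 hx), h0, h1]
          simp [sq]

theorem laplaceMoment_pos {w : ℝ → ℝ} (hm : Measurable w)
    (hw : ∀ t > 0, 0 < w t ∧ w t ≤ 1 + t) (k : ℕ) {x : ℝ} (hx : 0 < x) :
    0 < laplaceMoment w k x := by
  have hpos : ∀ t ∈ Ioi (0 : ℝ), 0 < t ^ k * (w t * exp (-(x * t))) := fun t ht => by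
    have := (hw t ht).1
    have : (0 : ℝ) < t := ht
    positivity
  rw [laplaceMoment, setIntegral_pos_iff_support_of_nonneg_ae
    (by filter_upwards [ae_restrict_mem measurableSet_Ioi] with t ht using (hpos t ht).le)
    (integrableOn_laplaceMoment hm (fun t ht => ⟨(hw t ht).1.le, (hw t ht).2⟩) k hx)]
  rw [inter_eq_right.2 fun t ht => Function.mem_support.2 (hpos t ht).ne']
  simp

theorem iteratedDeriv_laplaceMoment {w : ℝ → ℝ} (hm : Measurable w)
    (hw : ∀ t > 0, 0 ≤ w t ∧ w t ≤ 1 + t) :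
    ContinuousOn (laplaceMoment w 0) (Ioi 0) ∧ ∀ (k : ℕ) {x : ℝ}, 0 < x →
      iteratedDeriv k (laplaceMoment w 0) x = (-1) ^ k * laplaceMoment w k x := by
  let μ := (volume.restrict (Ioi (0 : ℝ))).withDensity fun t => ENNReal.ofReal (w t)
  let X : ℝ → ℝ := fun t => -t
  have hμ : ∀ F : ℝ → ℝ, ∫ t, F t ∂μ = ∫ t in Ioi 0, w t * F t := fun F => by
    rw [integral_withDensity_eq_integral_toReal_smul hm.ennreal_ofReal (by simp)]
    refine setIntegral_congr_fun measurableSet_Ioi fun t ht => ?_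
    simp [ENNReal.toReal_ofReal (hw t ht).1]
  have hmgf : ProbabilityTheory.mgf X μ = laplaceMoment w 0 := by
    ext x
    simp [ProbabilityTheory.mgf, hμ, laplaceMoment, X]
  have hint : Ioi 0 ⊆ interior (ProbabilityTheory.integrableExpSet X μ) := by
    refine interior_maximal (fun x (hx : 0 < x) => ?_) isOpen_Ioi
    rw [ProbabilityTheory.integrableExpSet, mem_ofPred_eq,
      integrable_withDensity_iff_integrable_smul' hm.ennreal_ofReal (by simp)]
    refine (integrableOn_laplaceMoment hm hw 0 hx).congr_fun (fun t ht => ?_) measurableSet_Ioi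
    simp [ENNReal.toReal_ofReal (hw t ht).1, X]
  refine ⟨hmgf ▸ ProbabilityTheory.continuousOn_mgf.mono hint, fun k x hx => ?_⟩
  rw [← hmgf, ProbabilityTheory.iteratedDeriv_mgf (hint hx), hμ, laplaceMoment,
    ← integral_const_mul]
  refine setIntegral_congr_fun measurableSet_Ioi fun t _ => ?_
  simp only [X]
  rw [neg_pow, mul_neg]
  ring

/-- The hypothesis `hmono` holds for every strictly log-concave weight. It makes the ratio of
the convolution `(t ^ m * w) ⋆ (t ^ n * w)` to `t ^ (m + n + 1) * w` strictly increasing, so that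
Chebyshev's integral inequality applies. -/
theorem laplaceMoment_mul_lt {w : ℝ → ℝ} (hm : Measurable w)
    (hw : ∀ t > 0, 0 < w t ∧ w t ≤ 1 + t)
    (hmono : ∀ {u s t : ℝ}, u ∈ Ioo (0 : ℝ) 1 → 0 < s → s < t →
      w (u * s) * w ((1 - u) * s) * w t < w (u * t) * w ((1 - u) * t) * w s)
    (m n : ℕ) {x : ℝ} (hx : 0 < x) :
    laplaceMoment w (m + n + 2) x * (laplaceMoment w m x * laplaceMoment w n x) <
      laplaceMoment w (m + n + 1) x *
        (laplaceMoment w (m + 1) x * laplaceMoment w n x +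
          laplaceMoment w m x * laplaceMoment w (n + 1) x) := by
  have hw' : ∀ t > 0, 0 ≤ w t ∧ w t ≤ 1 + t := fun t ht => ⟨(hw t ht).1.le, (hw t ht).2⟩
  let f : ℕ → ℝ → ℝ := fun k t => t ^ k * (w t * exp (-(x * t)))
  have hfm : ∀ k, Measurable (f k) := fun k => by fun_prop
  have hf : ∀ k, IntegrableOn (f k) (Ioi 0) := fun k => integrableOn_laplaceMoment hm hw' k hx
  have hfb : ∀ k s t, 0 < s → s < t → ‖f k s‖ ≤ t ^ k * (1 + t) := fun k s t hs hst => by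
    have := hw' s hs
    have ht := hs.trans hst
    rw [norm_of_nonneg (mul_nonneg (by positivity) (mul_nonneg this.1 (exp_pos _).le))]
    have h1 : exp (-(x * s)) ≤ 1 := exp_le_one_iff.2 (by nlinarith)
    have h2 : w s * exp (-(x * s)) ≤ (1 + t) * 1 :=
      mul_le_mul (by linarith) h1 (exp_pos _).le (by linarith)
    rw [mul_one] at h2
    exact mul_le_mul (by gcongr) h2 (mul_nonneg this.1 (exp_pos _).le) (by positivity)
  let c : ℕ → ℕ → ℝ → ℝ := fun i j t => ∫ s in (0 : ℝ)..t, f i s * f j (t - s)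
  have hcint : ∀ i j, ∫ t in Ioi 0, c i j t = laplaceMoment w i x * laplaceMoment w j x :=
    fun i j => integral_posConvolution (hf i) (hf j) (ContinuousLinearMap.mul ℝ ℝ)
  have hc : ∀ i j, IntegrableOn (c i j) (Ioi 0) := fun i j =>
    (integrable_indicator_iff measurableSet_Ioi).1
      (integrable_posConvolution (hf i) (hf j) (ContinuousLinearMap.mul ℝ ℝ))
  have hfint : ∀ i j t, 0 < t →
      IntervalIntegrable (fun s => f i s * f j (t - s)) volume 0 t := fun i j t ht => by
    rw [intervalIntegrable_iff_integrableOn_Ioo_of_le ht.le]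
    refine IntegrableOn.of_bound (by simp) (by fun_prop) (t ^ i * (1 + t) * (t ^ j * (1 + t))) ?_
    filter_upwards [ae_restrict_mem measurableSet_Ioo] with s hs
    rw [norm_mul]
    exact mul_le_mul (hfb i s t hs.1 hs.2) (hfb j (t - s) t (by linarith [hs.2])
      (by linarith [hs.1])) (norm_nonneg _) (by positivity)
  have hcadd : ∀ t ∈ Ioi (0 : ℝ), c (m + 1) n t + c m (n + 1) t = t * c m n t := fun t ht => by
    simp only [c]
    rw [← intervalIntegral.integral_add (hfint _ _ t ht) (hfint _ _ t ht),
      ← intervalIntegral.integral_const_mul]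
    congr 1
    ext s
    simp only [f]
    ring
  let p : ℝ → ℝ → ℝ := fun t u => u ^ m * (1 - u) ^ n * (w (u * t) * w ((1 - u) * t))
  let P : ℝ → ℝ := fun t => ∫ u in (0 : ℝ)..1, p t u
  have hp : ∀ t > 0, IntervalIntegrable (p t) volume 0 1 := fun t ht => by
    rw [intervalIntegrable_iff_integrableOn_Ioo_of_le zero_le_one]
    refine IntegrableOn.of_bound (by simp) (by fun_prop) ((1 + t) * (1 + t)) ?_
    filter_upwards [ae_restrict_mem measurableSet_Ioo] with u ⟨hu0, hu1⟩
    have hu1' : 0 < 1 - u := sub_pos.2 hu1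
    have ha := hw' _ (mul_pos hu0 ht)
    have hb := hw' _ (mul_pos hu1' ht)
    have hq : u ^ m * (1 - u) ^ n ≤ 1 :=
      mul_le_one₀ (pow_le_one₀ hu0.le hu1.le) (by positivity)
        (pow_le_one₀ hu1'.le (by linarith))
    have hab : w (u * t) * w ((1 - u) * t) ≤ (1 + t) * (1 + t) :=
      mul_le_mul (by nlinarith) (by nlinarith) hb.1 (by linarith)
    have hab0 := mul_nonneg ha.1 hb.1
    rw [norm_of_nonneg (by positivity)]
    exact (mul_le_of_le_one_left hab0 hq).trans hab
  have hcP : ∀ t > 0, c m n t = t ^ (m + n + 1) * exp (-(x * t)) * P t := fun t ht => by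
    have h := intervalIntegral.integral_comp_mul_right (a := 0) (b := 1)
      (fun s => f m s * f n (t - s)) ht.ne'
    simp only [zero_mul, one_mul, smul_eq_mul] at h
    have h2 : c m n t = t * ∫ u in (0 : ℝ)..1, f m (u * t) * f n (t - u * t) := by
      rw [h, mul_inv_cancel_left₀ ht.ne']
    rw [h2, ← intervalIntegral.integral_const_mul, ← intervalIntegral.integral_const_mul]
    congr 1
    ext u
    have he : exp (-(x * t)) = exp (-(x * (u * t))) * exp (-(x * ((1 - u) * t))) := by
      rw [← exp_add]; congr 1; ring
    simp only [f, p]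
    rw [he, show t - u * t = (1 - u) * t by ring, mul_pow, mul_pow]
    ring
  have hP : ∀ {s t}, 0 < s → s < t → P s * w t < P t * w s := fun {s t} hs hst => by
    have ht := hs.trans hst
    have h1 := (hp t ht).mul_const (w s)
    have h2 := (hp s hs).mul_const (w t)
    rw [← sub_pos, ← intervalIntegral.integral_mul_const, ← intervalIntegral.integral_mul_const,
      ← intervalIntegral.integral_sub h1 h2]
    refine intervalIntegral.intervalIntegral_pos_of_pos_on (h1.sub h2) (fun u hu => ?_) one_pos
    have := hmono hu hs hst
    have hu0 : 0 < u := hu.1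
    have hu1 : 0 < 1 - u := sub_pos.2 hu.2
    have hq : 0 < u ^ m * (1 - u) ^ n := by positivity
    simp only [p]
    nlinarith [mul_lt_mul_of_pos_left this hq]
  have hA := laplaceMoment_pos hm hw (m + n + 1) hx
  set τ := laplaceMoment w (m + n + 2) x / laplaceMoment w (m + n + 1) x with hτ
  have hτ0 : 0 < τ := div_pos (laplaceMoment_pos hm hw (m + n + 2) hx) hA
  let D : ℝ → ℝ := fun t => w τ * (c (m + 1) n t + c m (n + 1) t - τ * c m n t) -
    P τ * (f (m + n + 2) t - τ * f (m + n + 1) t)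
  have hDeq : ∀ t > 0, D t =
      t ^ (m + n + 1) * exp (-(x * t)) * ((t - τ) * (P t * w τ - P τ * w t)) := fun t ht => by
    simp only [D]
    rw [hcadd t ht, hcP t ht]
    simp only [f]
    ring
  have hDpos : ∀ t > 0, t ≠ τ → 0 < D t := fun t ht hne => by
    rw [hDeq t ht]
    refine mul_pos (by positivity) ?_
    rcases hne.lt_or_gt with h | h
    · exact mul_pos_of_neg_of_neg (by linarith) (by linarith [hP ht h])
    · exact mul_pos (by linarith) (by linarith [hP hτ0 h])
  have hi1 : IntegrableOn (fun t => c (m + 1) n t + c m (n + 1) t) (Ioi 0) := (hc _ _).add (hc _ _)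
  have hi2 : IntegrableOn (fun t => τ * c m n t) (Ioi 0) := (hc _ _).const_mul τ
  have hi3 : IntegrableOn (fun t => τ * f (m + n + 1) t) (Ioi 0) := (hf _).const_mul τ
  have hi4 : IntegrableOn (fun t => w τ * (c (m + 1) n t + c m (n + 1) t - τ * c m n t)) (Ioi 0) :=
    (hi1.sub hi2).const_mul _
  have hi5 : IntegrableOn (fun t => P τ * (f (m + n + 2) t - τ * f (m + n + 1) t)) (Ioi 0) :=
    ((hf _).sub hi3).const_mul _
  have hD : IntegrableOn D (Ioi 0) := hi4.sub hi5
  have hDint : ∫ t in Ioi 0, D t = w τ * (laplaceMoment w (m + 1) x * laplaceMoment w n x +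
      laplaceMoment w m x * laplaceMoment w (n + 1) x -
        τ * (laplaceMoment w m x * laplaceMoment w n x)) -
      P τ * (laplaceMoment w (m + n + 2) x - τ * laplaceMoment w (m + n + 1) x) := by
    simp only [D]
    rw [integral_sub hi4 hi5, integral_const_mul, integral_const_mul, integral_sub hi1 hi2,
      integral_sub (hf _) hi3, integral_add (hc _ _) (hc _ _), integral_const_mul,
      integral_const_mul, hcint, hcint, hcint]
    rfl
  have hDintpos : 0 < ∫ t in Ioi 0, D t := by
    rw [setIntegral_pos_iff_support_of_nonneg_ae _ hD]
    · refine lt_of_lt_of_le ?_ (measure_mono (s := Ioi τ) fun t ht => ?_)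
      · simp
      · have ht0 : 0 < t := hτ0.trans ht
        exact ⟨(hDpos t ht0 (ne_of_gt ht)).ne', ht0⟩
    · filter_upwards [ae_restrict_mem measurableSet_Ioi] with t ht
      rcases eq_or_ne t τ with h | h
      · rw [hDeq t ht, h]; simp
      · exact (hDpos t ht h).le
  rw [hDint, hτ, div_mul_cancel₀ _ hA.ne', sub_self, mul_zero, sub_zero, ← hτ] at hDintpos
  have := pos_of_mul_pos_right hDintpos (hw τ hτ0).1.le
  rw [hτ, sub_pos, div_mul_eq_mul_div, div_lt_iff₀ hA] at this
  linarith

theorem pos_of_hasDerivAt_pos {f f' : ℝ → ℝ} (hd : ∀ t, HasDerivAt f (f' t) t) (h0 : f 0 = 0)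
    (hpos : ∀ t > 0, 0 < f' t) {t : ℝ} (ht : 0 < t) : 0 < f t := by
  have : StrictMonoOn f (Ici 0) := by
    refine strictMonoOn_of_deriv_pos (convex_Ici 0)
      (fun y _ => (hd y).continuousAt.continuousWithinAt) fun y hy => ?_
    rw [interior_Ici] at hy
    exact (hd y).deriv ▸ hpos y hy
  simpa [h0] using this self_mem_Ici ht.le ht

theorem two_mul_exp_mul_sq_lt {t : ℝ} (ht : 0 < t) :
    2 * exp t * (exp t - 1 - t) ^ 2 < (exp t * (t - 1) + 1) * (exp t - 1) ^ 2 := by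
  have he : ∀ y, HasDerivAt exp (exp y) y := hasDerivAt_exp
  have hid : ∀ y : ℝ, HasDerivAt (fun y => y) 1 y := hasDerivAt_id'
  have he2 : ∀ y : ℝ, HasDerivAt (fun y => exp y ^ 2) (2 * exp y ^ 2) y := fun y =>
    ((he y).pow 2).congr_deriv (by simp; ring)
  have he3 : ∀ y : ℝ, HasDerivAt (fun y => exp y ^ 3) (3 * exp y ^ 3) y := fun y =>
    ((he y).pow 3).congr_deriv (by simp; ring)
  have hen : ∀ y : ℝ, HasDerivAt (fun y => exp (-y)) (-exp (-y)) y := fun y =>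
    ((hid y).neg.exp).congr_deriv (by simp)
  have hcancel : ∀ y : ℝ, exp (-y) * exp y = 1 := fun y => by rw [← exp_add]; simp
  have hlin : ∀ a b y : ℝ, HasDerivAt (fun y => a * y + b) a y := fun a b y =>
    (((hid y).const_mul a).add_const b).congr_deriv (by ring)
  have h5 : ∀ t > 0, 0 < exp t * (24 * t + -4) + 4 := fun t ht =>
    pos_of_hasDerivAt_pos (fun y => ((he y).mul (hlin 24 (-4) y)).add_const 4) (by norm_num)
      (fun y hy => by nlinarith [exp_pos y, mul_pos (exp_pos y) hy]) ht
  have h4 : ∀ t > 0, 0 < exp t * (24 * t + -28) + (4 * t + 28) := fun t ht =>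
    pos_of_hasDerivAt_pos (fun y => ((he y).mul (hlin 24 (-28) y)).add (hlin 4 28 y))
      (by norm_num) (fun y hy => by linarith [h5 y hy]) ht
  have h3 : ∀ t > 0, 0 < exp t ^ 3 * (8 * t + -12) + exp t ^ 2 * (2 * t + 13) + -1 := fun t ht =>
    pos_of_hasDerivAt_pos (fun y => (((he3 y).mul (hlin 8 (-12) y)).add
      ((he2 y).mul (hlin 2 13 y))).add_const (-1)) (by norm_num)
      (fun y hy => by nlinarith [mul_pos (pow_pos (exp_pos y) 2) (h4 y hy)]) ht
  have h2 : ∀ t > 0, 0 < exp t ^ 2 * (4 * t + -8) + exp t * (2 * t + 11) + exp (-t) + -4 :=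
    fun t ht => pos_of_hasDerivAt_pos (fun y => ((((he2 y).mul (hlin 4 (-8) y)).add
      ((he y).mul (hlin 2 11 y))).add (hen y)).add_const (-4)) (by norm_num)
      (fun y hy => by
        have := mul_pos (exp_pos (-y)) (h3 y hy)
        have e := hcancel y
        linear_combination this +
          (exp y ^ 2 * (8 * y - 12) + exp y * (2 * y + 13)) * e) ht
  have h1 : ∀ t > 0, 0 < exp t ^ 2 * (2 * t + -5) + exp t * (2 * t + 9) - exp (-t) + (-4 * t + -3) :=
    fun t ht => pos_of_hasDerivAt_pos (fun y => ((((he2 y).mul (hlin 2 (-5) y)).add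
      ((he y).mul (hlin 2 9 y))).sub (hen y)).add (hlin (-4) (-3) y)) (by norm_num)
      (fun y hy => by linarith [h2 y hy]) ht
  have h0 : 0 < exp t ^ 2 * (1 * t + -3) + exp t * (2 * t + 7) + exp (-t) +
      (-2 * t + -3) * t + -5 :=
    pos_of_hasDerivAt_pos (fun y => (((((he2 y).mul (hlin 1 (-3) y)).add
      ((he y).mul (hlin 2 7 y))).add (hen y)).add ((hlin (-2) (-3) y).mul (hid y))).add_const (-5))
      (by norm_num) (fun y hy => by linarith [h1 y hy]) ht
  linear_combination mul_pos (exp_pos t) h0 + hcancel t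

/-- The weight whose Laplace transform is the trigamma function. -/
noncomputable def trigammaWeight (t : ℝ) : ℝ := t * exp t / (exp t - 1)

/-- The weight whose Laplace transform is `Phi`; it is the derivative of `trigammaWeight`. -/
noncomputable def phiWeight (t : ℝ) : ℝ := exp t * (exp t - 1 - t) / (exp t - 1) ^ 2

theorem exp_sub_one_sub_pos {t : ℝ} (ht : 0 < t) : 0 < exp t - 1 - t := by
  linarith [add_one_lt_exp ht.ne']

theorem exp_sub_one_pos {t : ℝ} (ht : 0 < t) : 0 < exp t - 1 := by
  linarith [add_one_lt_exp ht.ne']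

theorem one_le_trigammaWeight {t : ℝ} (ht : 0 < t) : 1 ≤ trigammaWeight t := by
  rw [trigammaWeight, le_div_iff₀ (exp_sub_one_pos ht)]
  have := mul_le_mul_of_nonneg_left (add_one_le_exp (-t)) (exp_pos t).le
  rw [← exp_add, add_neg_cancel, exp_zero] at this
  linarith

theorem trigammaWeight_le {t : ℝ} (ht : 0 < t) : trigammaWeight t ≤ 1 + t := by
  rw [trigammaWeight, div_le_iff₀ (exp_sub_one_pos ht)]
  linarith [add_one_le_exp t]

theorem phiWeight_pos {t : ℝ} (ht : 0 < t) : 0 < phiWeight t :=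
  div_pos (mul_pos (exp_pos t) (exp_sub_one_sub_pos ht)) (pow_pos (exp_sub_one_pos ht) 2)

theorem phiWeight_le_one {t : ℝ} (ht : 0 < t) : phiWeight t ≤ 1 := by
  rw [phiWeight, div_le_one (pow_pos (exp_sub_one_pos ht) 2)]
  have := mul_le_mul_of_nonneg_left (add_one_le_exp (-t)) (exp_pos t).le
  rw [← exp_add, add_neg_cancel, exp_zero] at this
  linarith

theorem measurable_trigammaWeight : Measurable trigammaWeight := by
  unfold trigammaWeight; fun_prop

theorem measurable_phiWeight : Measurable phiWeight := by
  unfold phiWeight; fun_prop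

theorem hasDerivAt_trigammaWeight {t : ℝ} (ht : 0 < t) :
    HasDerivAt trigammaWeight (phiWeight t) t := by
  refine (((hasDerivAt_id' t).mul (hasDerivAt_exp t)).div ((hasDerivAt_exp t).sub_const 1)
    (exp_sub_one_pos ht).ne').congr_deriv ?_
  rw [phiWeight]
  congr 1
  simp only [Pi.mul_apply]
  ring

theorem log_phiWeight {t : ℝ} (ht : 0 < t) :
    log (phiWeight t) = t + log (exp t - 1 - t) - 2 * log (exp t - 1) := by
  rw [phiWeight, log_div (mul_pos (exp_pos t) (exp_sub_one_sub_pos ht)).ne'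
    (pow_pos (exp_sub_one_pos ht) 2).ne', log_mul (exp_pos t).ne' (exp_sub_one_sub_pos ht).ne',
    log_exp, log_pow]
  norm_num

/-- The logarithmic derivative of `phiWeight`. -/
noncomputable def phiWeightLogDeriv (t : ℝ) : ℝ :=
  1 + (exp t - 1) / (exp t - 1 - t) - 2 * (exp t / (exp t - 1))

theorem hasDerivAt_log_phiWeight {t : ℝ} (ht : 0 < t) :
    HasDerivAt (fun t => log (phiWeight t)) (phiWeightLogDeriv t) t := by
  have h1 := (hasDerivAt_exp t).sub_const 1
  refine HasDerivAt.congr_of_eventuallyEq (((hasDerivAt_id' t).add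
    ((h1.sub (hasDerivAt_id' t)).log (exp_sub_one_sub_pos ht).ne')).sub
    ((h1.log (exp_sub_one_pos ht).ne').const_mul 2)) ?_
  filter_upwards [Ioi_mem_nhds ht] with s hs using log_phiWeight hs

theorem strictAntiOn_phiWeightLogDeriv : StrictAntiOn phiWeightLogDeriv (Ioi 0) := by
  have hd : ∀ t > 0, HasDerivAt phiWeightLogDeriv
      ((2 * exp t * (exp t - 1 - t) ^ 2 - (exp t * (t - 1) + 1) * (exp t - 1) ^ 2) /
        ((exp t - 1 - t) ^ 2 * (exp t - 1) ^ 2)) t := fun t ht => by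
    have hp := (exp_sub_one_pos ht).ne'
    have hq := (exp_sub_one_sub_pos ht).ne'
    have h1 := (hasDerivAt_exp t).sub_const 1
    refine (((h1.div (h1.sub (hasDerivAt_id' t)) hq).const_add 1).sub
      (((hasDerivAt_exp t).div h1 hp).const_mul 2)).congr_deriv ?_
    simp only [Pi.sub_apply]
    field_simp
    ring
  refine strictAntiOn_of_deriv_neg (convex_Ioi 0)
    (fun t ht => (hd t ht).continuousAt.continuousWithinAt) fun t ht => ?_
  rw [interior_Ioi] at ht
  rw [(hd t ht).deriv]
  have hp := exp_sub_one_pos ht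
  have hq := exp_sub_one_sub_pos ht
  exact div_neg_of_neg_of_pos (by linarith [two_mul_exp_mul_sq_lt ht]) (by positivity)

theorem phiWeight_mul_lt {u s t : ℝ} (hu : u ∈ Ioo (0 : ℝ) 1) (hs : 0 < s) (hst : s < t) :
    phiWeight (u * s) * phiWeight ((1 - u) * s) * phiWeight t <
      phiWeight (u * t) * phiWeight ((1 - u) * t) * phiWeight s := by
  have hu0 : 0 < u := hu.1
  have hu1 : 0 < 1 - u := sub_pos.2 hu.2
  have ht := hs.trans hst
  let R : ℝ → ℝ := fun t =>
    log (phiWeight (u * t)) + log (phiWeight ((1 - u) * t)) - log (phiWeight t)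
  have hscale : ∀ c > 0, ∀ t > 0, HasDerivAt (fun t => log (phiWeight (c * t)))
      (phiWeightLogDeriv (c * t) * c) t := fun c hc t ht =>
    (hasDerivAt_log_phiWeight (mul_pos hc ht)).comp t
      (((hasDerivAt_id' t).const_mul c).congr_deriv (mul_one c))
  have hd : ∀ t > 0, HasDerivAt R (phiWeightLogDeriv (u * t) * u +
      phiWeightLogDeriv ((1 - u) * t) * (1 - u) - phiWeightLogDeriv t) t := fun t ht =>
    ((hscale u hu0 t ht).add (hscale (1 - u) hu1 t ht)).sub (hasDerivAt_log_phiWeight ht)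
  have hR : StrictMonoOn R (Ioi 0) := by
    refine strictMonoOn_of_deriv_pos (convex_Ioi 0)
      (fun t ht => (hd t ht).continuousAt.continuousWithinAt) fun t ht => ?_
    rw [interior_Ioi] at ht
    have ht' : 0 < t := ht
    rw [(hd t ht).deriv]
    have h1 := strictAntiOn_phiWeightLogDeriv (mul_pos hu0 ht') ht (by nlinarith)
    have h2 := strictAntiOn_phiWeightLogDeriv (mul_pos hu1 ht') ht (by nlinarith)
    nlinarith
  have key := hR hs ht hst
  have p : ∀ {c r : ℝ}, 0 < c → 0 < r → 0 < phiWeight (c * r) := fun hc hr =>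
    phiWeight_pos (mul_pos hc hr)
  have h1 := p hu0 hs
  have h2 := p hu1 hs
  have h3 := p hu0 ht
  have h4 := p hu1 ht
  have h5 := phiWeight_pos hs
  have h6 := phiWeight_pos ht
  rw [← log_lt_log_iff (by positivity) (by positivity), log_mul (by positivity) h6.ne',
    log_mul h1.ne' h2.ne', log_mul (by positivity) h5.ne', log_mul h3.ne' h4.ne']
  simp only [R] at key
  linarith

theorem trigammaWeight_bounds {t : ℝ} (ht : 0 < t) :
    0 ≤ trigammaWeight t ∧ trigammaWeight t ≤ 1 + t :=
  ⟨zero_le_one.trans (one_le_trigammaWeight ht), trigammaWeight_le ht⟩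

theorem phiWeight_bounds {t : ℝ} (ht : 0 < t) : 0 < phiWeight t ∧ phiWeight t ≤ 1 + t :=
  ⟨phiWeight_pos ht, (phiWeight_le_one ht).trans (by linarith)⟩

theorem trigamma_eq_laplaceMoment {x : ℝ} (hx : 0 < x) :
    iteratedDeriv 2 (fun y => log (Gamma y)) x = laplaceMoment trigammaWeight 0 x := by
  have hm := measurable_trigammaWeight
  have hw := fun t (ht : t > 0) => trigammaWeight_bounds ht
  refine iteratedDeriv_two_log_Gamma_eq (iteratedDeriv_laplaceMoment hm hw).1 (fun y _ => ?_)
    (fun y hy => ?_) (laplaceMoment_tendsto_zero hm hw) hx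
  · refine setIntegral_nonneg measurableSet_Ioi fun t ht => ?_
    have := (hw t ht).1
    positivity
  · have h1 := integral_pow_mul_exp 1 hy
    rw [Nat.factorial_one, Nat.cast_one] at h1
    rw [← h1, laplaceMoment, laplaceMoment, ← integral_sub
      (integrableOn_laplaceMoment hm hw 0 hy) (integrableOn_pow_mul_exp 1 hy)]
    refine setIntegral_congr_fun measurableSet_Ioi fun t ht => ?_
    have he : exp (-((y + 1) * t)) = exp (-(y * t)) / exp t := by
      rw [← exp_sub]; congr 1; ring
    have hp := (exp_sub_one_pos ht).ne'
    have hq := (exp_pos t).ne'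
    simp only [he, trigammaWeight]
    field_simp
    ring

theorem mul_laplaceMoment_trigammaWeight {x : ℝ} (hx : 0 < x) :
    x * laplaceMoment trigammaWeight 0 x - 1 = laplaceMoment phiWeight 0 x := by
  have hg := integrableOn_laplaceMoment measurable_trigammaWeight
    (fun t ht => trigammaWeight_bounds ht) 0 hx
  have hh := integrableOn_laplaceMoment measurable_phiWeight
    (fun t ht => ⟨(phiWeight_bounds ht).1.le, (phiWeight_bounds ht).2⟩) 0 hx
  have hg' := hg.const_mul x
  have hexp : Tendsto (fun t => exp (-(x * t))) atTop (𝓝 0) :=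
    tendsto_exp_neg_atTop_nhds_zero.comp (tendsto_id.const_mul_atTop hx)
  have htexp : Tendsto (fun t => t * exp (-(x * t))) atTop (𝓝 0) := by
    have := ((tendsto_pow_mul_exp_neg_atTop_nhds_zero 1).comp
      (tendsto_id.const_mul_atTop hx)).const_mul x⁻¹
    rw [mul_zero] at this
    refine this.congr fun t => ?_
    simp only [Function.comp_apply, id, pow_one]
    field_simp
  have hzero : Tendsto (trigammaWeight * fun t => exp (-(x * t))) (𝓝[>] 0) (𝓝 1) := by
    have h1 : Tendsto trigammaWeight (𝓝[>] 0) (𝓝 1) := by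
      have hlin : Tendsto (fun t : ℝ => 1 + t) (𝓝[>] 0) (𝓝 1) := by
        have : Continuous fun t : ℝ => 1 + t := by fun_prop
        simpa using (this.tendsto 0).mono_left nhdsWithin_le_nhds
      refine tendsto_of_tendsto_of_tendsto_of_le_of_le' tendsto_const_nhds hlin ?_ ?_
      · filter_upwards [self_mem_nhdsWithin] with t ht using one_le_trigammaWeight ht
      · filter_upwards [self_mem_nhdsWithin] with t ht using trigammaWeight_le ht
    have h2 : Tendsto (fun t => exp (-(x * t))) (𝓝[>] 0) (𝓝 1) := by
      have : Continuous fun t => exp (-(x * t)) := by fun_prop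
      simpa using (this.tendsto 0).mono_left nhdsWithin_le_nhds
    rw [← one_mul (1 : ℝ)]
    exact h1.mul h2
  have hinfty : Tendsto (trigammaWeight * fun t => exp (-(x * t))) atTop (𝓝 0) := by
    have hlim := hexp.add htexp
    rw [add_zero] at hlim
    refine tendsto_of_tendsto_of_tendsto_of_le_of_le' tendsto_const_nhds hlim ?_ ?_
    · filter_upwards [eventually_gt_atTop 0] with t ht
      exact mul_nonneg (trigammaWeight_bounds ht).1 (exp_pos _).le
    · filter_upwards [eventually_gt_atTop 0] with t ht
      rw [← one_add_mul]
      exact mul_le_mul_of_nonneg_right (trigammaWeight_le ht) (exp_pos _).le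
  have hderiv : ∀ t ∈ Ioi (0 : ℝ),
      HasDerivAt (fun t => exp (-(x * t))) (-x * exp (-(x * t))) t := fun t _ =>
    (((hasDerivAt_id' t).const_mul x).neg.exp).congr_deriv (by simp [mul_comm])
  have hparts := integral_Ioi_deriv_mul_eq_sub (fun t ht => hasDerivAt_trigammaWeight ht) hderiv
    ((hh.sub hg').congr_fun (fun t _ => by simp; ring) measurableSet_Ioi) hzero hinfty
  have hsub := integral_sub hh hg'
  rw [integral_const_mul] at hsub
  have heq : ∫ t in Ioi 0, (phiWeight t * exp (-(x * t)) +
      trigammaWeight t * (-x * exp (-(x * t)))) = laplaceMoment phiWeight 0 x -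
        x * laplaceMoment trigammaWeight 0 x := by
    rw [laplaceMoment, laplaceMoment, ← hsub]
    congr 1
    ext t
    ring
  linarith

theorem iteratedDeriv_Phi (k : ℕ) {x : ℝ} (hx : 0 < x) :
    iteratedDeriv k Phi x = (-1) ^ k * laplaceMoment phiWeight k x := by
  have : Phi =ᶠ[𝓝 x] laplaceMoment phiWeight 0 := by
    filter_upwards [Ioi_mem_nhds hx] with y hy
    rw [Phi, trigamma_eq_laplaceMoment hy, mul_laplaceMoment_trigammaWeight hy]
  rw [this.iteratedDeriv_eq k]
  exact (iteratedDeriv_laplaceMoment measurable_phiWeight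
    fun t ht => ⟨(phiWeight_bounds ht).1.le, (phiWeight_bounds ht).2⟩).2 k hx

theorem Phi_deriv_product_inequality (m n : ℕ) (x : ℝ) (hx : 0 < x) :
    iteratedDeriv (m + n + 2) Phi x * (iteratedDeriv m Phi x * iteratedDeriv n Phi x) <
      iteratedDeriv (m + n + 1) Phi x *
        (iteratedDeriv (m + 1) Phi x * iteratedDeriv n Phi x +
          iteratedDeriv m Phi x * iteratedDeriv (n + 1) Phi x) := by
  have h := laplaceMoment_mul_lt measurable_phiWeight (fun t ht => phiWeight_bounds ht)
    phiWeight_mul_lt m n hx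
  simp only [iteratedDeriv_Phi _ hx, pow_add, pow_one]
  rcases neg_one_pow_eq_or ℝ m with hm | hm <;> rcases neg_one_pow_eq_or ℝ n with hn | hn <;>
    rw [hm, hn] <;> linarith
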